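/- Let d ≥ 1 be an integer and a > 0 a real number. Then Σ_{i=1}^∞ e^{−a i^{2/d}} i^{(d+1)/d} ≤ 1 + (d/2) Γ(d + 1/2) a^{−(2d+1)/2}, and Σ_{i=1}^∞ e^{−a i^{2/d}} i ≤ 1 + (d/2) Γ(d) a^{−d}, where Γ is the Gamma function. -/

import Mathlib

/-- The derivative of `exp (-a u ^ p) u ^ r (A + B w + C w ^ 2)`, where `w = a u ^ p`. -/
lemma hasDerivAt_exp_neg_rpow_mul_quadratic (a p r A B C : ℝ) {u : ℝ} (hu : 0 < u) :
    HasDerivAt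
      (fun u : ℝ => Real.exp (-(a * u ^ p)) * u ^ r * (A + B * (a * u ^ p) + C * (a * u ^ p) ^ 2))
      (Real.exp (-(a * u ^ p)) * u ^ (r - 1) *
        ((r - p * (a * u ^ p)) * (A + B * (a * u ^ p) + C * (a * u ^ p) ^ 2) +
          p * (a * u ^ p) * (B + 2 * C * (a * u ^ p)))) u := by
  have hw : HasDerivAt (fun u : ℝ => a * u ^ p) (a * (p * u ^ (p - 1))) u :=
    (Real.hasDerivAt_rpow_const (Or.inl hu.ne')).const_mul a
  have hr : HasDerivAt (fun u : ℝ => u ^ r) (r * u ^ (r - 1)) u :=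
    Real.hasDerivAt_rpow_const (Or.inl hu.ne')
  have hq := ((hw.const_mul B).const_add A).add ((hw.pow 2).const_mul C)
  refine ((hw.neg.exp.mul hr).mul hq).congr_deriv ?_
  simp only [Pi.add_apply, Pi.mul_apply, Pi.pow_apply, Pi.neg_apply]
  rw [Real.rpow_sub_one hu.ne', Real.rpow_sub_one hu.ne']
  field_simp
  ring

/-- A bound for the periodic cubic kernel of the Euler-Maclaurin formula. -/
lemma abs_eulerMaclaurin_cubic_le {x : ℝ} (h0 : 0 ≤ x) (h1 : x ≤ 1) :
    |x ^ 3 / 6 - x ^ 2 / 4 + x / 12| ≤ 1 / 120 := by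
  rw [abs_le]
  constructor
  · nlinarith [mul_nonneg (sq_nonneg (x - 1 / 2 - 0.29)) (show 0 ≤ x - 1 / 2 + 0.58 by linarith)]
  · nlinarith [mul_nonneg (sq_nonneg (1 / 2 - x - 0.29)) (show 0 ≤ 1 / 2 - x + 0.58 by linarith)]

/-- One step of the third-order Euler-Maclaurin formula: if `G` is an antiderivative of `g` and
`|g'''|` is dominated by the derivative of `S`, the corrected trapezoidal rule on `[n, n + 1]`
exceeds the integral by at most `1 / 120` of the increment of `S`. -/
lemma corrected_trapezoid_le {G g g₁ g₂ g₃ S S' : ℝ → ℝ} {n : ℝ}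
    (hG : ∀ u, n ≤ u → HasDerivAt G (g u) u) (hg : ∀ u, n ≤ u → HasDerivAt g (g₁ u) u)
    (hg₁ : ∀ u, n ≤ u → HasDerivAt g₁ (g₂ u) u) (hg₂ : ∀ u, n ≤ u → HasDerivAt g₂ (g₃ u) u)
    (hS : ∀ u, n ≤ u → HasDerivAt S (S' u) u) (hle : ∀ u, n ≤ u → |g₃ u| ≤ S' u) :
    (g n + g (n + 1)) / 2 - (g₁ (n + 1) - g₁ n) / 12 ≤
      G (n + 1) - G n + (S (n + 1) - S n) / 120 := by
  let k₃ : ℝ → ℝ := fun x => x ^ 3 / 6 - x ^ 2 / 4 + x / 12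
  let k₂ : ℝ → ℝ := fun x => x ^ 2 / 2 - x / 2 + 1 / 12
  let k₁ : ℝ → ℝ := fun x => x - 1 / 2
  let Ψ : ℝ → ℝ := fun x =>
    G (n + x) + S (n + x) / 120 - (k₃ x * g₂ (n + x) - k₂ x * g₁ (n + x) + k₁ x * g (n + x))
  have hk₃ (x : ℝ) : HasDerivAt k₃ (k₂ x) x := by
    refine ((((hasDerivAt_id x).pow 3).div_const 6).sub (((hasDerivAt_id x).pow 2).div_const 4)
      |>.add ((hasDerivAt_id x).div_const 12)).congr_deriv ?_
    simp only [k₂, id]; ring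
  have hk₂ (x : ℝ) : HasDerivAt k₂ (k₁ x) x := by
    refine ((((hasDerivAt_id x).pow 2).div_const 2).sub ((hasDerivAt_id x).div_const 2)
      |>.add_const (1 / 12)).congr_deriv ?_
    simp only [k₁, id]; ring
  have hk₁ (x : ℝ) : HasDerivAt k₁ 1 x := (hasDerivAt_id x).sub_const _
  have hΨ (x : ℝ) (hx : 0 ≤ x) :
      HasDerivAt Ψ (S' (n + x) / 120 - k₃ x * g₃ (n + x)) x := by
    have hn : n ≤ n + x := by linarith
    refine ((((hG _ hn).comp_const_add n x).add
      (((hS _ hn).comp_const_add n x).div_const 120)).sub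
      ((((hk₃ x).mul ((hg₂ _ hn).comp_const_add n x)).sub
        ((hk₂ x).mul ((hg₁ _ hn).comp_const_add n x))).add
        ((hk₁ x).mul ((hg _ hn).comp_const_add n x)))).congr_deriv ?_
    ring
  have hmono : MonotoneOn Ψ (Set.Icc 0 1) := by
    refine monotoneOn_of_hasDerivWithinAt_nonneg (convex_Icc 0 1)
      (fun x hx => (hΨ x hx.1).continuousAt.continuousWithinAt)
      (fun x hx => (hΨ x (interior_subset hx).1).hasDerivWithinAt) fun x hx => ?_
    have hx' : x ∈ Set.Icc (0 : ℝ) 1 := interior_subset hx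
    have h := mul_le_mul (abs_eulerMaclaurin_cubic_le hx'.1 hx'.2)
      (hle (n + x) (by linarith [hx'.1])) (abs_nonneg _) (by norm_num)
    rw [← abs_mul] at h
    have := (le_abs_self _).trans h
    simp only [k₃]
    linarith
  have h := hmono (Set.left_mem_Icc.2 zero_le_one) (Set.right_mem_Icc.2 zero_le_one) zero_le_one
  simp only [Ψ, k₁, k₂, k₃, add_zero] at h
  linarith

section

variable {a p q : ℝ}

/-- The third derivative of `exp (-a u ^ p) u ^ q` on `[1, ∞)` is dominated by an expression with
an elementary antiderivative. -/
lemma abs_third_deriv_exp_neg_rpow_mul_rpow_le (ha : 0 < a) (hp : 0 < p) (hp2 : p ≤ 2)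
    (hq : 1 ≤ q) (hq2 : q ≤ 2) {u : ℝ} (hu : 1 ≤ u) :
    |Real.exp (-(a * u ^ p)) * u ^ (q - 3) *
      (q * (q - 1) * (q - 2) - p * ((2 * q - 1 + p) * (q - 2 + p) + q * (q - 1)) * (a * u ^ p) +
        3 * p ^ 2 * (q - 1 + p) * (a * u ^ p) ^ 2 - p ^ 3 * (a * u ^ p) ^ 3)| ≤
    q * (q - 1) * (2 - q) * u ^ (q - 3) + Real.exp (-(a * u ^ p)) * u ^ (-1 : ℝ) *
      (p * (a * u ^ p) * (12 + 9 * p * (a * u ^ p) + p ^ 2 * (a * u ^ p) ^ 2)) := by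
  have hu0 : 0 < u := by linarith
  have hw : 0 ≤ a * u ^ p := by positivity
  set w := a * u ^ p
  have hc₀ : 0 ≤ q * (q - 1) * (2 - q) :=
    mul_nonneg (mul_nonneg (by linarith) (by linarith)) (by linarith)
  have hc₁ : |(2 * q - 1 + p) * (q - 2 + p) + q * (q - 1)| ≤ 12 := by
    rw [abs_le]
    constructor <;> nlinarith
  have hpoly : |q * (q - 1) * (q - 2) -
      p * ((2 * q - 1 + p) * (q - 2 + p) + q * (q - 1)) * w +
      3 * p ^ 2 * (q - 1 + p) * w ^ 2 - p ^ 3 * w ^ 3| ≤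
      q * (q - 1) * (2 - q) + p * w * (12 + 9 * p * w + p ^ 2 * w ^ 2) := by
    have hpw : 0 ≤ p * w := by positivity
    have hp3 : 0 ≤ p ^ 3 * w ^ 3 := by positivity
    have hp2w : 0 ≤ p ^ 2 * w ^ 2 := by positivity
    rw [abs_le] at hc₁ ⊢
    have h1 := mul_le_mul_of_nonneg_left hc₁.1 hpw
    have h2 := mul_le_mul_of_nonneg_left hc₁.2 hpw
    have h3 := mul_le_mul_of_nonneg_left (show q - 1 + p ≤ 3 by linarith) hp2w
    have h4 := mul_nonneg hp2w (show 0 ≤ q - 1 + p by linarith)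
    constructor <;> linarith
  rw [abs_mul, abs_of_pos (by positivity)]
  refine (mul_le_mul_of_nonneg_left hpoly (by positivity)).trans ?_
  rw [mul_add]
  have hexp : Real.exp (-w) ≤ 1 := Real.exp_le_one_iff.2 (by linarith)
  have hrpow : u ^ (q - 3) ≤ u ^ (-1 : ℝ) := Real.rpow_le_rpow_of_exponent_le hu (by linarith)
  gcongr ?_ + ?_
  · calc Real.exp (-w) * u ^ (q - 3) * (q * (q - 1) * (2 - q))
        ≤ 1 * u ^ (q - 3) * (q * (q - 1) * (2 - q)) := by gcongr
      _ = _ := by ring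
  · gcongr

/-- The partial sums of `exp (-a i ^ p) i ^ q` exceed the integral over `(0, ∞)` by at most `1`. -/
lemma sum_exp_neg_rpow_mul_rpow_le (ha : 0 < a) (hp : 0 < p) (hp2 : p ≤ 2)
    (hq : 1 ≤ q) (hq2 : q ≤ 2) (N : ℕ) :
    ∑ i ∈ Finset.range N, Real.exp (-(a * ((i : ℝ) + 1) ^ p)) * ((i : ℝ) + 1) ^ q ≤
      1 + ∫ u in Set.Ioi (0 : ℝ), u ^ q * Real.exp (-a * u ^ p) := by
  let g : ℝ → ℝ := fun u => Real.exp (-(a * u ^ p)) * u ^ q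
  let g₁ : ℝ → ℝ := fun u => Real.exp (-(a * u ^ p)) * u ^ (q - 1) * (q - p * (a * u ^ p))
  let g₂ : ℝ → ℝ := fun u => Real.exp (-(a * u ^ p)) * u ^ (q - 2) *
    (q * (q - 1) - p * (2 * q - 1 + p) * (a * u ^ p) + p ^ 2 * (a * u ^ p) ^ 2)
  let S : ℝ → ℝ := fun u => -(q * (q - 1) * u ^ (q - 2)) - Real.exp (-(a * u ^ p)) *
    (12 + 9 * p + 2 * p ^ 2 + (9 * p + 2 * p ^ 2) * (a * u ^ p) + p ^ 2 * (a * u ^ p) ^ 2)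
  let G : ℝ → ℝ := fun u => ∫ t in (0 : ℝ)..u, g t
  have hgc : Continuous g := by
    have h1 : Continuous fun u : ℝ => u ^ p := Real.continuous_rpow_const hp.le
    have h2 : Continuous fun u : ℝ => u ^ q := Real.continuous_rpow_const (by linarith)
    fun_prop
  have hG (u : ℝ) : HasDerivAt G (g u) u := hgc.integral_hasStrictDerivAt 0 u |>.hasDerivAt
  have hg (u : ℝ) (hu : 0 < u) : HasDerivAt g (g₁ u) u := by
    have h := hasDerivAt_exp_neg_rpow_mul_quadratic a p q 1 0 0 hu
    simp only [zero_mul, add_zero, mul_one, mul_zero] at h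
    exact h
  have hg₁ (u : ℝ) (hu : 0 < u) : HasDerivAt g₁ (g₂ u) u := by
    have h := hasDerivAt_exp_neg_rpow_mul_quadratic a p (q - 1) q (-p) 0 hu
    rw [show q - 1 - 1 = q - 2 by ring] at h
    refine (h.congr_deriv ?_).congr_of_eventuallyEq (.of_forall fun v => ?_)
    · simp only [g₂]; ring
    · simp only [g₁]; ring
  have hg₂ (u : ℝ) (hu : 0 < u) : HasDerivAt g₂ (Real.exp (-(a * u ^ p)) * u ^ (q - 3) *
      (q * (q - 1) * (q - 2) - p * ((2 * q - 1 + p) * (q - 2 + p) + q * (q - 1)) * (a * u ^ p) +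
        3 * p ^ 2 * (q - 1 + p) * (a * u ^ p) ^ 2 - p ^ 3 * (a * u ^ p) ^ 3)) u := by
    have h := hasDerivAt_exp_neg_rpow_mul_quadratic a p (q - 2) (q * (q - 1))
      (-(p * (2 * q - 1 + p))) (p ^ 2) hu
    rw [show q - 2 - 1 = q - 3 by ring] at h
    refine (h.congr_deriv ?_).congr_of_eventuallyEq (.of_forall fun v => ?_)
    · ring
    · simp only [g₂]; ring
  have hS (u : ℝ) (hu : 0 < u) : HasDerivAt S (q * (q - 1) * (2 - q) * u ^ (q - 3) +
      Real.exp (-(a * u ^ p)) * u ^ (-1 : ℝ) *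
        (p * (a * u ^ p) * (12 + 9 * p * (a * u ^ p) + p ^ 2 * (a * u ^ p) ^ 2))) u := by
    have h1 : HasDerivAt (fun u : ℝ => u ^ (q - 2)) ((q - 2) * u ^ (q - 2 - 1)) u :=
      Real.hasDerivAt_rpow_const (Or.inl hu.ne')
    have h2 := hasDerivAt_exp_neg_rpow_mul_quadratic a p 0 (12 + 9 * p + 2 * p ^ 2)
      (9 * p + 2 * p ^ 2) (p ^ 2) hu
    rw [show q - 2 - 1 = q - 3 by ring] at h1
    rw [zero_sub] at h2
    refine (((h1.const_mul (q * (q - 1))).neg.sub h2).congr_deriv ?_).congr_of_eventuallyEq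
      (.of_forall fun v => ?_)
    · ring
    · simp [S]
  have hstep (n : ℕ) : (g (n + 1) + g (n + 1 + 1)) / 2 - (g₁ (n + 1 + 1) - g₁ (n + 1)) / 12 ≤
      G (n + 1 + 1) - G (n + 1) + (S (n + 1 + 1) - S (n + 1)) / 120 := by
    have hpos (u : ℝ) (hu : (n : ℝ) + 1 ≤ u) : 1 ≤ u := by
      linarith [n.cast_nonneg (α := ℝ)]
    exact corrected_trapezoid_le (fun u _ => hG u)
      (fun u hu => hg u (by linarith [hpos u hu])) (fun u hu => hg₁ u (by linarith [hpos u hu]))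
      (fun u hu => hg₂ u (by linarith [hpos u hu])) (fun u hu => hS u (by linarith [hpos u hu]))
      fun u hu => abs_third_deriv_exp_neg_rpow_mul_rpow_le ha hp hp2 hq hq2 (hpos u hu)
  have hsum : ∑ i ∈ Finset.range N, g ((i : ℝ) + 1) ≤
      g 1 / 2 - g (N + 1) / 2 + (g₁ (N + 1) - g₁ 1) / 12 + (G (N + 1) - G 1) +
        (S (N + 1) - S 1) / 120 := by
    induction N with
    | zero => simp
    | succ N ih =>
      rw [Finset.sum_range_succ]
      push_cast
      linarith [hstep N]
  have hM : (1 : ℝ) ≤ (N : ℝ) + 1 := by linarith [N.cast_nonneg (α := ℝ)]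
  generalize (N : ℝ) + 1 = M at hsum hM
  have hM0 : 0 < M := by linarith
  have hgM : g₁ M / 12 ≤ g M / 2 := by
    have hw : 0 ≤ p * (a * M ^ p) := by positivity
    have h1 : M ^ (q - 1) ≤ M ^ q := Real.rpow_le_rpow_of_exponent_le hM (by linarith)
    have h2 : g₁ M ≤ Real.exp (-(a * M ^ p)) * M ^ q * 2 := by
      refine (mul_le_mul_of_nonneg_left (show q - p * (a * M ^ p) ≤ 2 by linarith)
        (by positivity)).trans ?_
      gcongr
    have h3 : 0 ≤ g M := by positivity
    change g₁ M ≤ g M * 2 at h2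
    linarith
  have hSM : S M ≤ 0 := by
    have h1 : 0 ≤ q * (q - 1) * M ^ (q - 2) :=
      mul_nonneg (mul_nonneg (by linarith) (by linarith)) (by positivity)
    have h2 : 0 ≤ Real.exp (-(a * M ^ p)) * (12 + 9 * p + 2 * p ^ 2 +
      (9 * p + 2 * p ^ 2) * (a * M ^ p) + p ^ 2 * (a * M ^ p) ^ 2) := by positivity
    simp only [S]
    linarith
  have hS1 : -40 ≤ S 1 := by
    have h1 : Real.exp (-a) * (12 + 9 * p + 2 * p ^ 2 + (9 * p + 2 * p ^ 2) * a +
        p ^ 2 * a ^ 2) ≤ 38 := by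
      rw [Real.exp_neg, inv_mul_le_iff₀ (Real.exp_pos a)]
      have hpp : p ^ 2 ≤ 4 := by nlinarith
      have h2 : (9 * p + 2 * p ^ 2) * a ≤ 26 * a := by gcongr; linarith
      have h3 : p ^ 2 * a ^ 2 ≤ 4 * a ^ 2 := by gcongr
      nlinarith [Real.quadratic_le_exp_of_nonneg ha.le, sq_nonneg a]
    simp only [S, Real.one_rpow, mul_one]
    nlinarith
  have hg1 : g 1 / 2 - g₁ 1 / 12 ≤ 1 / 2 := by
    have h1 : Real.exp (-a) * (1 / 2 - (q - p * a) / 12) ≤ 1 / 2 := by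
      rw [Real.exp_neg, inv_mul_le_iff₀ (Real.exp_pos a)]
      nlinarith [Real.add_one_le_exp a]
    simp only [g, g₁, Real.one_rpow, mul_one]
    linarith
  have hg0 (u : ℝ) (hu : 0 ≤ u) : 0 ≤ g u := mul_nonneg (Real.exp_pos _).le (by positivity)
  have hG1 : 0 ≤ G 1 := intervalIntegral.integral_nonneg zero_le_one fun u hu => hg0 u hu.1
  have hGM : G M ≤ ∫ u in Set.Ioi (0 : ℝ), u ^ q * Real.exp (-a * u ^ p) := by
    have heq : (fun u : ℝ => u ^ q * Real.exp (-a * u ^ p)) = g := by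
      funext u
      rw [neg_mul, mul_comm]
    have hint : MeasureTheory.IntegrableOn g (Set.Ioi 0) := by
      rw [← heq]
      exact integrableOn_rpow_mul_exp_neg_mul_rpow (by linarith) hp ha
    rw [heq]
    simp only [G]
    rw [intervalIntegral.integral_of_le hM0.le]
    refine MeasureTheory.setIntegral_mono_set hint ?_ Set.Ioc_subset_Ioi_self.eventuallyLE
    exact (MeasureTheory.ae_restrict_mem measurableSet_Ioi).mono fun u hu => hg0 u (le_of_lt hu)
  change ∑ i ∈ Finset.range N, g ((i : ℝ) + 1) ≤ _
  linarith

/-- The series of `exp (-a i ^ p) i ^ q` over `i ≥ 1` is at most `1` plus its integral. -/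
lemma tsum_exp_neg_rpow_mul_rpow_le (ha : 0 < a) (hp : 0 < p) (hp2 : p ≤ 2)
    (hq : 1 ≤ q) (hq2 : q ≤ 2) :
    ∑' i : ℕ, Real.exp (-a * ((i : ℝ) + 1) ^ p) * ((i : ℝ) + 1) ^ q ≤
      1 + a ^ (-(q + 1) / p) * (1 / p) * Real.Gamma ((q + 1) / p) := by
  rw [← integral_rpow_mul_exp_neg_mul_rpow hp (by linarith) ha]
  refine Real.tsum_le_of_sum_range_le (fun i => by positivity) fun N => ?_
  simpa only [neg_mul] using sum_exp_neg_rpow_mul_rpow_le ha hp hp2 hq hq2 N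

end


/-- Integral-comparison bounds for the spectral series: for an integer `d ≥ 1` and `a > 0`,
`Σ_{i=1}^∞ e^{-a i^{2/d}} i^{(d+1)/d} ≤ 1 + (d/2) Γ(d + 1/2) a^{-(2d+1)/2}` and
`Σ_{i=1}^∞ e^{-a i^{2/d}} i ≤ 1 + (d/2) Γ(d) a^{-d}`. -/
theorem spectral_series_tail_bounds (d : ℕ) (hd : 1 ≤ d) (a : ℝ) (ha : 0 < a) :
    (∑' i : ℕ, Real.exp (-a * ((i : ℝ) + 1) ^ ((2 : ℝ) / d)) *
        ((i : ℝ) + 1) ^ (((d : ℝ) + 1) / d) ≤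
      1 + ((d : ℝ) / 2) * Real.Gamma ((d : ℝ) + 1 / 2) * a ^ (-(2 * (d : ℝ) + 1) / 2)) ∧
    (∑' i : ℕ, Real.exp (-a * ((i : ℝ) + 1) ^ ((2 : ℝ) / d)) * ((i : ℝ) + 1) ≤
      1 + ((d : ℝ) / 2) * Real.Gamma (d : ℝ) * a ^ (-(d : ℝ))) := by
  have hd1 : (1 : ℝ) ≤ d := by exact_mod_cast hd
  have hd0 : (0 : ℝ) < d := by linarith
  have hp : (0 : ℝ) < 2 / d := by positivity
  have hp2 : (2 : ℝ) / d ≤ 2 := by rw [div_le_iff₀ hd0]; linarith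
  constructor
  · have hq : 1 ≤ ((d : ℝ) + 1) / d := by rw [le_div_iff₀ hd0]; linarith
    have hq2 : ((d : ℝ) + 1) / d ≤ 2 := by rw [div_le_iff₀ hd0]; linarith
    refine (tsum_exp_neg_rpow_mul_rpow_le ha hp hp2 hq hq2).trans_eq ?_
    rw [show -(((d : ℝ) + 1) / d + 1) / (2 / d) = -(2 * (d : ℝ) + 1) / 2 by field_simp; ring,
      show (((d : ℝ) + 1) / d + 1) / (2 / d) = (d : ℝ) + 1 / 2 by field_simp; ring, one_div_div]
    ring
  · have h := tsum_exp_neg_rpow_mul_rpow_le ha hp hp2 le_rfl one_le_two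
    simp only [Real.rpow_one] at h
    refine h.trans_eq ?_
    rw [show -((1 : ℝ) + 1) / (2 / d) = -(d : ℝ) by field_simp; ring,
      show ((1 : ℝ) + 1) / (2 / d) = (d : ℝ) by field_simp; ring, one_div_div]
    ring
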